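/- arXiv:2209.06474 — 3 statements merged into one kernel-verified Lean document; each statement's English description precedes it below -/
import Mathlib

section
/- Let A be the 5×9 real matrix A = [[0,-1,1,-1,0,0,-1,0,0],[1,0,-1,0,-1,0,0,-1,0],[-1,1,0,0,0,-1,0,0,-1],[0,0,0,1,1,1,0,0,0],[0,0,0,0,0,0,1,1,1]] and B the 5×5 matrix with diagonal entries -4/5 and all off-diagonal entries 1/5 (the system A·F_d = B·F_p encoding the half-diamond mass balances of a triangular prism, with unknown dual-flux vector F_d ∈ ℝ⁹ and given primal-flux vector F_p ∈ ℝ⁵). Then: (i) the sum of the five rows of A is the zero vector of ℝ⁹, and the sum of the five rows of B is the zero vector of ℝ⁵; consequently rank(A) ≤ 4 and the kernel of A (as a linear map ℝ⁹ → ℝ⁵) has dimension at least 5; (ii) for every F_p ∈ ℝ⁵ the system A·F_d = B·F_p admits a solution, and its solution set is an infinite affine subspace of ℝ⁹ of dimension at least 5. -/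
/-- The linear system A·F_d = B·F_p encoding the half-diamond mass balances of a
triangular prism: the rows of A and of B each sum to zero, hence rank(A) ≤ 4 and
dim ker(A) ≥ 5; the system is solvable for every primal flux vector F_p, and its
solution set is an infinite affine subspace of ℝ⁹ (a translate of ker(A), which has
dimension ≥ 5). -/
theorem prism_system_underdetermined
    (A : Matrix (Fin 5) (Fin 9) ℝ) (B : Matrix (Fin 5) (Fin 5) ℝ)
    (hA : A = !![0, -1, 1, -1, 0, 0, -1, 0, 0;
                 1, 0, -1, 0, -1, 0, 0, -1, 0;
                 -1, 1, 0, 0, 0, -1, 0, 0, -1;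
                 0, 0, 0, 1, 1, 1, 0, 0, 0;
                 0, 0, 0, 0, 0, 0, 1, 1, 1])
    (hB : B = !![-4/5, 1/5, 1/5, 1/5, 1/5;
                 1/5, -4/5, 1/5, 1/5, 1/5;
                 1/5, 1/5, -4/5, 1/5, 1/5;
                 1/5, 1/5, 1/5, -4/5, 1/5;
                 1/5, 1/5, 1/5, 1/5, -4/5]) :
    -- (i) the rows of A sum to zero, and the rows of B sum to zero
    (∑ i : Fin 5, A i = 0) ∧
    (∑ i : Fin 5, B i = 0) ∧
    -- consequently rank(A) ≤ 4 and ker(A : ℝ⁹ → ℝ⁵) has dimension at least 5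
    A.rank ≤ 4 ∧
    5 ≤ Module.finrank ℝ (LinearMap.ker A.mulVecLin) ∧
    -- (ii) for every F_p the system A·F_d = B·F_p has a solution, and the solution
    -- set is an infinite affine subspace: a translate of ker(A) (of dimension ≥ 5)
    (∀ Fp : Fin 5 → ℝ,
      (∃ Fd : Fin 9 → ℝ, A.mulVec Fd = B.mulVec Fp) ∧
      {Fd : Fin 9 → ℝ | A.mulVec Fd = B.mulVec Fp}.Infinite ∧
      (∃ Fd₀ : Fin 9 → ℝ, A.mulVec Fd₀ = B.mulVec Fp ∧
        {Fd : Fin 9 → ℝ | A.mulVec Fd = B.mulVec Fp}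
          = (fun v => Fd₀ + v) '' (LinearMap.ker A.mulVecLin : Set (Fin 9 → ℝ)))) := by
  have hr : A.rank ≤ 4 := by
    have h : A = (!![1, 0, 0, 0; 0, 1, 0, 0; 0, 0, 1, 0; 0, 0, 0, 1; -1, -1, -1, -1] :
        Matrix (Fin 5) (Fin 4) ℝ) *
        (!![0, -1, 1, -1, 0, 0, -1, 0, 0;
            1, 0, -1, 0, -1, 0, 0, -1, 0;
            -1, 1, 0, 0, 0, -1, 0, 0, -1;
            0, 0, 0, 1, 1, 1, 0, 0, 0] : Matrix (Fin 4) (Fin 9) ℝ) := by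
      rw [hA]
      ext i j
      fin_cases i <;> fin_cases j <;> simp [Matrix.mul_apply, Fin.sum_univ_succ]
    rw [h]
    exact (Matrix.rank_mul_le_left _ _).trans (Matrix.rank_le_width _)
  have hk : 5 ≤ Module.finrank ℝ (LinearMap.ker A.mulVecLin) := by
    have h := LinearMap.finrank_range_add_finrank_ker A.mulVecLin
    rw [Module.finrank_fin_fun] at h
    have h2 : Module.finrank ℝ (LinearMap.range A.mulVecLin) ≤ 4 := hr
    omega
  refine ⟨?_, ?_, hr, hk, ?_⟩
  · have h : ∀ j, ∑ i : Fin 5, A i j = 0 := by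
      intro j
      rw [hA]
      fin_cases j <;> simp [Fin.sum_univ_succ]
    funext j
    exact (Finset.sum_apply j _ _).trans (h j)
  · have h : ∀ j, ∑ i : Fin 5, B i j = 0 := by
      intro j
      rw [hB]
      fin_cases j <;> simp [Fin.sum_univ_succ] <;> norm_num
    funext j
    exact (Finset.sum_apply j _ _).trans (h j)
  · intro Fp
    have hex : ∃ Fd : Fin 9 → ℝ, A.mulVec Fd = B.mulVec Fp := by
      have hs : ∀ b : Fin 5 → ℝ, b 0 + b 1 + b 2 + b 3 + b 4 = 0 →
          ∃ Fd : Fin 9 → ℝ, A.mulVec Fd = b := by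
        intro b hb
        refine ⟨![b 1, b 1 + b 2, 0, b 3, 0, 0, b 4, 0, 0], ?_⟩
        rw [hA]
        ext i
        fin_cases i <;> simp [Matrix.mulVec, dotProduct, Fin.sum_univ_succ] <;> linarith
      apply hs
      rw [hB]
      simp [Matrix.mulVec, dotProduct, Fin.sum_univ_succ]
      ring
    obtain ⟨x, hx⟩ := hex
    have hker : A.mulVec ![1, 1, 1, 0, 0, 0, 0, 0, 0] = 0 := by
      rw [hA]
      ext i
      fin_cases i <;> simp [Matrix.mulVec, dotProduct, Fin.sum_univ_succ]
    refine ⟨⟨x, hx⟩, ?_, x, hx, ?_⟩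
    · refine Set.infinite_of_injective_forall_mem
        (f := fun n : ℕ => x + (n : ℝ) • ![1, 1, 1, 0, 0, 0, 0, 0, 0]) ?_ ?_
      · intro m n h
        have h0 := congrFun h 0
        simpa using h0
      · intro n
        simp only [Set.mem_setOf_eq]
        rw [Matrix.mulVec_add, Matrix.mulVec_smul, hker, hx, smul_zero, add_zero]
    · ext y
      simp only [Set.mem_setOf_eq, Set.mem_image, SetLike.mem_coe, LinearMap.mem_ker,
        Matrix.mulVecLin_apply]
      constructor
      · intro hy
        exact ⟨y - x, by rw [Matrix.mulVec_sub, hy, hx, sub_self], by abel⟩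
      · rintro ⟨v, hv, rfl⟩
        rw [Matrix.mulVec_add, hv, hx, add_zero]
end

section
/- Let K and L be two cells sharing a face σ₀, with E_K and E_L their finite face sets (σ₀ ∈ E_K and σ₀ ∈ E_L). Let |K|, |L|, d_K, d_L (the volumes of the half-diamonds D_{K,σ₀} and D_{L,σ₀}) and δt be positive reals. Let F_K : E_K → ℝ and F_L : E_L → ℝ be primal fluxes with F_K(σ₀) = -F_L(σ₀), and let ρ_K, ρ_K', ρ_L, ρ_L' be reals satisfying the primal mass balances (|K|/δt)(ρ_K' - ρ_K) + Σ_{σ ∈ E_K} F_K(σ) = 0 and (|L|/δt)(ρ_L' - ρ_L) + Σ_{σ ∈ E_L} F_L(σ) = 0. Let (G_ε)_{ε ∈ A_K} and (G_ε)_{ε ∈ A_L} be finite families of reals (the dual fluxes leaving D_σ₀ through its faces contained in K, respectively in L) satisfying the constraint (H1): F_K(σ₀) + Σ_{ε ∈ A_K} G_ε = (d_K/|K|)·Σ_{σ ∈ E_K} F_K(σ), and F_L(σ₀) + Σ_{ε ∈ A_L} G_ε = (d_L/|L|)·Σ_{σ ∈ E_L} F_L(σ). Then, setting |D| = d_K +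 d_L, ρ_D = (d_K·ρ_K + d_L·ρ_L)/|D| and ρ_D' = (d_K·ρ_K' + d_L·ρ_L')/|D|, the finite volume mass balance holds on the dual cell: (|D|/δt)(ρ_D' - ρ_D) + Σ_{ε ∈ A_K} G_ε + Σ_{ε ∈ A_L} G_ε = 0. -/
/-- If the primal mass balances hold on two cells K and L sharing the face σ₀, the
primal flux through σ₀ is conservative, and the dual fluxes leaving the diamond cell
D_{σ₀} through its faces contained in K (resp. L) satisfy the half-diamond constraint
(H1), then the finite volume mass balance holds on the dual cell D_{σ₀} with the
volume-weighted dual densities. -/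
theorem dual_cell_mass_balance
    {α β : Type*} [DecidableEq α]
    (EK EL : Finset α) (σ₀ : α) (hσK : σ₀ ∈ EK) (hσL : σ₀ ∈ EL)
    (volK volL dK dL δt : ℝ)
    (hvolK : 0 < volK) (hvolL : 0 < volL) (hdK : 0 < dK) (hdL : 0 < dL)
    (hδt : 0 < δt)
    (FK FL : α → ℝ) (hcons : FK σ₀ = -FL σ₀)
    (ρK ρK' ρL ρL' : ℝ)
    (hmassK : volK / δt * (ρK' - ρK) + ∑ σ ∈ EK, FK σ = 0)
    (hmassL : volL / δt * (ρL' - ρL) + ∑ σ ∈ EL, FL σ = 0)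
    (AK AL : Finset β) (G : β → ℝ)
    (hH1K : FK σ₀ + ∑ ε ∈ AK, G ε = dK / volK * ∑ σ ∈ EK, FK σ)
    (hH1L : FL σ₀ + ∑ ε ∈ AL, G ε = dL / volL * ∑ σ ∈ EL, FL σ) :
    (dK + dL) / δt *
        ((dK * ρK' + dL * ρL') / (dK + dL) - (dK * ρK + dL * ρL) / (dK + dL))
      + (∑ ε ∈ AK, G ε) + (∑ ε ∈ AL, G ε) = 0 := by
  have hK : dK / volK * ∑ σ ∈ EK, FK σ = -(dK / δt * (ρK' - ρK)) := by
    rw [eq_neg_of_add_eq_zero_right hmassK]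
    field_simp
  have hL : dL / volL * ∑ σ ∈ EL, FL σ = -(dL / δt * (ρL' - ρL)) := by
    rw [eq_neg_of_add_eq_zero_right hmassL]
    field_simp
  have hD : (dK + dL) / δt *
        ((dK * ρK' + dL * ρL') / (dK + dL) - (dK * ρK + dL * ρL) / (dK + dL))
      = dK / δt * (ρK' - ρK) + dL / δt * (ρL' - ρL) := by
    have : dK + dL ≠ 0 := by positivity
    field_simp
    ring
  rw [hD]
  linarith
end

section
/- Let γ > 1, ρ > 0, p > 0 and u ∈ ℝ be real numbers. Define ω₂ = u(3 - γ)/4 + (1/2)·√(u²(γ + 1)²/4 + 4γp/ρ). Then: (i) ω₂ > 0 and ω₂ > u; (ii) ω₂ satisfies the quadratic equation ω₂² - ω₂·u(3 - γ)/2 - ((γ - 1)u²/2 + γp/ρ) = 0; (iii) defining the reflected state ρ₂ = ρ(ω₂ - u)/ω₂ and p₂ = ρu(u - ω₂) + p, one has ρ₂ > 0 and the left state (0, ρ₂, p₂) and right state (u, ρ, p) satisfy all three Rankine–Hugoniot conditions across a discontinuity moving with speed ω₂: ρ₂(0 - ω₂) = ρ(u - ω₂); p₂ = ρu(u - ω₂)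 + p; and ρ₂·E₂·(0 - ω₂) + p₂·0 = ρ·E·(u - ω₂) + p·u, where E₂ = p₂/((γ - 1)ρ₂) and E = (1/2)u² + p/((γ - 1)ρ); (iv) if moreover u ≤ 0 then p₂ ≥ p > 0. -/
/-- The reflected-shock state: given an incoming state (u, ρ, p), the reflected shock
speed ω₂ = u(3-γ)/4 + (1/2)√(u²(γ+1)²/4 + 4γp/ρ) is positive and larger than u,
solves the quadratic ω² - ω·u(3-γ)/2 - ((γ-1)u²/2 + γp/ρ) = 0, and the reflected
state (0, ρ₂, p₂) with ρ₂ = ρ(ω₂-u)/ω₂, p₂ = ρu(u-ω₂) + p has positive density and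
satisfies the Rankine–Hugoniot conditions across a discontinuity of speed ω₂;
moreover if u ≤ 0 then p₂ ≥ p. -/
theorem reflected_shock_state
    (γ ρ p u : ℝ) (hγ : 1 < γ) (hρ : 0 < ρ) (hp : 0 < p)
    (ω₂ ρ₂ p₂ E E₂ : ℝ)
    (hω₂ : ω₂ = u * (3 - γ) / 4
        + (1 / 2) * Real.sqrt (u ^ 2 * (γ + 1) ^ 2 / 4 + 4 * γ * p / ρ))
    (hρ₂ : ρ₂ = ρ * (ω₂ - u) / ω₂)
    (hp₂ : p₂ = ρ * u * (u - ω₂) + p)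
    (hE : E = (1 / 2) * u ^ 2 + p / ((γ - 1) * ρ))
    (hE₂ : E₂ = p₂ / ((γ - 1) * ρ₂)) :
    -- (i)
    (0 < ω₂ ∧ u < ω₂) ∧
    -- (ii)
    (ω₂ ^ 2 - ω₂ * (u * (3 - γ) / 2) - ((γ - 1) * u ^ 2 / 2 + γ * p / ρ) = 0) ∧
    -- (iii)
    (0 < ρ₂ ∧
      ρ₂ * (0 - ω₂) = ρ * (u - ω₂) ∧
      p₂ = ρ * u * (u - ω₂) + p ∧
      ρ₂ * E₂ * (0 - ω₂) + p₂ * 0 = ρ * E * (u - ω₂) + p * u) ∧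
    -- (iv)
    (u ≤ 0 → p ≤ p₂) := by
  have hc : 0 < γ * p / ρ := by positivity
  have hg : 0 < γ - 1 := by linarith
  have harg : 0 ≤ u ^ 2 * (γ + 1) ^ 2 / 4 + 4 * γ * p / ρ := by positivity
  have hs0 := Real.sqrt_nonneg (u ^ 2 * (γ + 1) ^ 2 / 4 + 4 * γ * p / ρ)
  have hs2 := Real.sq_sqrt harg
  set s := Real.sqrt (u ^ 2 * (γ + 1) ^ 2 / 4 + 4 * γ * p / ρ) with hs
  have e4 : 4 * γ * p / ρ = 4 * (γ * p / ρ) := by ring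
  rw [e4] at hs2
  have hq : ω₂ ^ 2 - ω₂ * (u * (3 - γ) / 2) - ((γ - 1) * u ^ 2 / 2 + γ * p / ρ) = 0 := by
    rw [hω₂]
    linear_combination hs2 / 4
  have h1 : 0 < ω₂ := by
    have h : -(u * (3 - γ) / 2) < s := by
      apply lt_of_pow_lt_pow_left₀ 2 hs0
      rw [hs2]
      nlinarith [mul_nonneg hg.le (sq_nonneg u)]
    rw [hω₂]; linarith
  have h2 : u < ω₂ := by
    have h : u * (1 + γ) / 2 < s := by
      apply lt_of_pow_lt_pow_left₀ 2 hs0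
      rw [hs2]
      nlinarith
    rw [hω₂]; linarith
  have h3 : 0 < ρ₂ := by
    rw [hρ₂]
    exact div_pos (mul_pos hρ (by linarith)) h1
  have h4 : ρ₂ * (0 - ω₂) = ρ * (u - ω₂) := by
    rw [hρ₂]; field_simp; ring
  have hq' : ρ * (ω₂ ^ 2 - ω₂ * (u * (3 - γ) / 2) - (γ - 1) * u ^ 2 / 2) = γ * p := by
    have : ρ * (γ * p / ρ) = γ * p := by field_simp
    linear_combination ρ * hq + this
  have h5 : ρ₂ * E₂ = p₂ / (γ - 1) := by
    rw [hE₂]; field_simp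
  have h6 : ρ * E = ρ * u ^ 2 / 2 + p / (γ - 1) := by
    rw [hE]; field_simp
  refine ⟨⟨h1, h2⟩, hq, ⟨h3, h4, hp₂, ?_⟩, ?_⟩
  · rw [h5, h6, hp₂]
    have hg' : γ - 1 ≠ 0 := hg.ne'
    field_simp
    linear_combination 2 * u * hq'
  · intro hu
    rw [hp₂]
    nlinarith [mul_nonneg (mul_nonneg hρ.le (neg_nonneg.2 hu)) (sub_nonneg.2 h2.le)]
end
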